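/- Bracketing construction for the marked indicator class (key step establishing assumption (A2) in the proof of Theorem 3.1(ii)): Let (U, X) be ℝ×ℝ^d-valued with X having density f; let γ > 0 and Q ≥ 2 an even integer; let σ², c: ℝ^d → [0,∞) be measurable with E[U² | X] = σ²(X) a.s. and E[|U|^{i(2+γ)/2} | X] ≤ c(X)^i a.s. for all integers 2 ≤ i ≤ Q; set c̄ = max{σ², c², …, c^Q} and assume M := ∫ c̄(u) f(u) du < ∞. Then for every ε > 0 there exist an integer N ≤ (2dM/ε² + 1)^d and pairs of grid points a_1 ≤ b_1, …, a_N ≤ b_N in the extended space ([−∞,∞])^d whose cells (a_j, b_j] partition ℝ^d, such that for every z ∈ ℝ^d there is j ∈ {1,…,N} with: (i) | u·1{x ≤ z} − u·1{x ≤ b_j} | ≤ b*_j(u,x) := |u| ( 1{x ≤ b_j} − 1{x ≤ a_j} ) for all (u,x) ∈ ℝ×ℝ^d; (ii) E[ b*_j(U,X)² ] ≤ ε²; and (iii) E[ b*_j(U,X)^{i(2+γ)/2} ] ≤ ε² for every integer 2 ≤ i ≤ Q. Consequently the bracketing number of the class F = {(u,x) ↦ u·1{x ≤ z} : z ∈ ℝ^d}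 in L₂ satisfies Ñ(ε, F, ‖·‖_{L₂}) = O(ε^{−2d}). -/

import Mathlib

open MeasureTheory Set

noncomputable section

/-- Indicator (with value in `ℝ`) of the extended lower-left orthant `{x : x ≤ v}`
for a corner `v` with coordinates in `[-∞,∞]`. -/
def indE {d : ℕ} (v : Fin d → EReal) (x : Fin d → ℝ) : ℝ :=
  {p : Fin d → ℝ | ∀ i, (p i : EReal) ≤ v i}.indicator (fun _ => (1 : ℝ)) x

/-- Indicator (with value in `ℝ`) of the lower-left orthant `{x : x ≤ z}`, `z ∈ ℝ^d`. -/
def indR {d : ℕ} (z : Fin d → ℝ) (x : Fin d → ℝ) : ℝ :=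
  {p : Fin d → ℝ | p ≤ z}.indicator (fun _ => (1 : ℝ)) x

/-- The half-open cell `(a, b]` in `ℝ^d` with extended-real corners. -/
def cellE {d : ℕ} (a b : Fin d → EReal) : Set (Fin d → ℝ) :=
  {x | ∀ i, a i < (x i : EReal) ∧ (x i : EReal) ≤ b i}

/-- `c̄ = max{σ², c², …, c^Q}`. -/
def cbar {d : ℕ} (σ2 c : (Fin d → ℝ) → ℝ) (Q : ℕ) (u : Fin d → ℝ) : ℝ :=
  (insert (σ2 u) ((Finset.Icc 2 Q).image fun i => c u ^ i)).max'
    (Finset.insert_nonempty _ _)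

lemma exists_monotone_grid {G : EReal → ℝ} (hG : Continuous G) (hmono : Monotone G)
    (hbot : G ⊥ = 0) {δ : ℝ} (hδ : 0 < δ) {k : ℕ} (hk : 0 < k)
    (hle : ∀ n < k, n * δ ≤ G ⊤) (htop : G ⊤ ≤ k * δ) :
    ∃ t : ℕ → EReal, Monotone t ∧ t 0 = ⊥ ∧ t k = ⊤ ∧
      ∀ n < k, G (t (n + 1)) - G (t n) ≤ δ := by
  have key : ∀ n : ℕ, ∃ y : EReal, (n = 0 → y = ⊥) ∧ (k ≤ n → y = ⊤) ∧
      (n < k → G y = n * δ) := by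
    intro n
    rcases Nat.eq_zero_or_pos n with rfl | hn
    · exact ⟨⊥, fun _ => rfl, fun h => absurd h (by omega), fun _ => by simp [hbot]⟩
    · by_cases hnk : k ≤ n
      · exact ⟨⊤, fun h => absurd h hn.ne', fun _ => rfl, fun h => absurd h (by omega)⟩
      · obtain ⟨y, hy⟩ := mem_range_of_exists_le_of_exists_ge hG (c := n * δ)
          ⟨⊥, by rw [hbot]; positivity⟩ ⟨⊤, hle n (by omega)⟩
        exact ⟨y, fun h => absurd h hn.ne', fun h => absurd h hnk, fun _ => hy⟩
  choose t ht0 htk htG using key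
  refine ⟨t, ?_, ht0 0 rfl, htk k le_rfl, fun n hn => ?_⟩
  · refine monotone_nat_of_le_succ fun n => ?_
    by_cases hn : k ≤ n + 1
    · rw [htk _ hn]; exact le_top
    · by_contra! hlt
      have := hmono hlt.le
      rw [htG n (by omega), htG (n + 1) (by omega)] at this
      push_cast at this
      nlinarith
  · rw [htG n hn]
    rcases Nat.lt_or_ge (n + 1) k with h | h
    · rw [htG _ h]; push_cast; linarith
    · obtain rfl : k = n + 1 := by omega
      rw [htk _ le_rfl]; push_cast at htop; linarith

section Marginal

variable {d : ℕ}

lemma measurableSet_coord_le (i : Fin d) (y : EReal) :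
    MeasurableSet {x : Fin d → ℝ | (x i : EReal) ≤ y} :=
  measurableSet_le (measurable_coe_real_ereal.comp (measurable_pi_apply i)) measurable_const

variable {L : Measure (Fin d → ℝ)} {h : (Fin d → ℝ) → ℝ}

lemma continuous_marginal_mass (hL : ∀ (i : Fin d) (r : ℝ), L {x | x i = r} = 0)
    (hh : Integrable h L) (i : Fin d) :
    Continuous fun y : EReal => ∫ x in {x : Fin d → ℝ | (x i : EReal) ≤ y}, h x ∂L := by
  have heq : (fun y : EReal => ∫ x in {x : Fin d → ℝ | (x i : EReal) ≤ y}, h x ∂L) =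
      fun y => ∫ x, {x : Fin d → ℝ | (x i : EReal) ≤ y}.indicator h x ∂L := by
    funext y
    rw [integral_indicator (measurableSet_coord_le i y)]
  rw [heq, continuous_iff_continuousAt]
  intro y₀
  have hnull : ∀ᵐ x ∂L, ((x i : ℝ) : EReal) ≠ y₀ := by
    induction y₀ with
    | bot => simp
    | top => simp
    | coe r =>
      rw [ae_iff]
      simpa using hL i r
  refine continuousAt_of_dominated (bound := fun x => ‖h x‖) ?_ ?_ hh.norm ?_
  · exact .of_forall fun y => hh.aestronglyMeasurable.indicator (measurableSet_coord_le i y)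
  · exact .of_forall fun y => .of_forall fun x => norm_indicator_le_norm_self _ _
  · filter_upwards [hnull] with x hx
    rcases lt_or_gt_of_ne hx with hlt | hlt
    · refine (continuousAt_const (y := h x)).congr ?_
      filter_upwards [lt_mem_nhds hlt] with y hy
      exact (indicator_of_mem (s := {x : Fin d → ℝ | (x i : EReal) ≤ y}) hy.le h).symm
    · refine (continuousAt_const (y := (0 : ℝ))).congr ?_
      filter_upwards [gt_mem_nhds hlt] with y hy
      exact (indicator_of_notMem (s := {x : Fin d → ℝ | (x i : EReal) ≤ y})
        (fun h' => absurd h' (not_le.2 hy)) h).symm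

lemma exists_axis_grid (hL : ∀ (i : Fin d) (r : ℝ), L {x | x i = r} = 0)
    (hh : Integrable h L) (hh0 : ∀ x, 0 ≤ h x) {δ : ℝ} (hδ : 0 < δ) {k : ℕ} (hk : 0 < k)
    (hle : ∀ n < k, n * δ ≤ ∫ x, h x ∂L) (htop : ∫ x, h x ∂L ≤ k * δ) (i : Fin d) :
    ∃ t : ℕ → EReal, Monotone t ∧ t 0 = ⊥ ∧ t k = ⊤ ∧ ∀ n < k,
      ∫ x in {x : Fin d → ℝ | t n < x i ∧ (x i : EReal) ≤ t (n + 1)}, h x ∂L ≤ δ := by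
  have hsub : ∀ y y' : EReal, y ≤ y' →
      {x : Fin d → ℝ | (x i : EReal) ≤ y} ⊆ {x : Fin d → ℝ | (x i : EReal) ≤ y'} :=
    fun y y' hy x hx => le_trans hx hy
  obtain ⟨t, ht, ht0, htk, htG⟩ := exists_monotone_grid (continuous_marginal_mass hL hh i)
    (fun y y' hy => setIntegral_mono_set hh.integrableOn (.of_forall hh0)
      (hsub y y' hy).eventuallyLE) (by simp) hδ hk (by simpa using hle) (by simpa using htop)
  refine ⟨t, ht, ht0, htk, fun n hn => ?_⟩
  have hset : {x : Fin d → ℝ | t n < x i ∧ (x i : EReal) ≤ t (n + 1)} =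
      {x : Fin d → ℝ | (x i : EReal) ≤ t (n + 1)} \ {x : Fin d → ℝ | (x i : EReal) ≤ t n} := by
    ext x
    simp [and_comm]
  rw [hset, setIntegral_sdiff (measurableSet_coord_le i _) hh.integrableOn
    (hsub _ _ (ht n.le_succ))]
  exact htG n hn

lemma measurableSet_orthant (v : Fin d → EReal) :
    MeasurableSet {p : Fin d → ℝ | ∀ i, (p i : EReal) ≤ v i} := by
  rw [ofPred_forall]
  exact .iInter fun i => measurableSet_coord_le i (v i)

lemma setIntegral_orthant_sdiff_le_sum (hh : Integrable h L) (hh0 : ∀ x, 0 ≤ h x)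
    (a b : Fin d → EReal) :
    ∫ x in {p : Fin d → ℝ | ∀ i, (p i : EReal) ≤ b i} \
        {p : Fin d → ℝ | ∀ i, (p i : EReal) ≤ a i}, h x ∂L ≤
      ∑ i, ∫ x in {x : Fin d → ℝ | a i < x i ∧ (x i : EReal) ≤ b i}, h x ∂L := by
  have hmeas : ∀ i, MeasurableSet {x : Fin d → ℝ | a i < x i ∧ (x i : EReal) ≤ b i} := by
    intro i
    have : {x : Fin d → ℝ | a i < x i ∧ (x i : EReal) ≤ b i} =
        {x : Fin d → ℝ | (x i : EReal) ≤ b i} \ {x : Fin d → ℝ | (x i : EReal) ≤ a i} := by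
      ext x
      simp [and_comm]
    rw [this]
    exact (measurableSet_coord_le i _).diff (measurableSet_coord_le i _)
  rw [← integral_indicator ((measurableSet_orthant b).diff (measurableSet_orthant a))]
  simp_rw [← integral_indicator (hmeas _)]
  rw [← integral_finsetSum _ fun i _ => hh.indicator (hmeas i)]
  refine integral_mono
    (hh.indicator ((measurableSet_orthant b).diff (measurableSet_orthant a)))
    (integrable_finsetSum _ fun i _ => hh.indicator (hmeas i)) fun x => ?_
  refine indicator_apply_le' (fun hx => ?_)
    fun _ => Finset.sum_nonneg fun i _ => indicator_nonneg (fun x _ => hh0 x) x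
  obtain ⟨hxb, hxa⟩ := hx
  obtain ⟨i, hi⟩ : ∃ i, a i < (x i : EReal) := by simpa using hxa
  calc h x = {x : Fin d → ℝ | a i < x i ∧ (x i : EReal) ≤ b i}.indicator h x :=
        (indicator_of_mem (s := {x : Fin d → ℝ | a i < x i ∧ (x i : EReal) ≤ b i})
          ⟨hi, hxb i⟩ h).symm
    _ ≤ _ := Finset.single_le_sum
        (f := fun i => {x : Fin d → ℝ | a i < x i ∧ (x i : EReal) ≤ b i}.indicator h x)
        (fun i _ => indicator_nonneg (fun x _ => hh0 x) x) (Finset.mem_univ i)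

end Marginal

section Orthant

variable {d : ℕ} {a b : Fin d → EReal} {z : Fin d → ℝ}

lemma indE_sub_indE (hab : a ≤ b) (x : Fin d → ℝ) :
    indE b x - indE a x = ({p : Fin d → ℝ | ∀ i, (p i : EReal) ≤ b i} \
      {p : Fin d → ℝ | ∀ i, (p i : EReal) ≤ a i}).indicator (fun _ => (1 : ℝ)) x := by
  rw [indicator_sdiff' fun x hx i => (hx i).trans (hab i)]
  rfl

lemma indE_le_indR (hz : z ∈ cellE a b) (x : Fin d → ℝ) : indE a x ≤ indR z x :=
  indicator_le_indicator_of_subset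
    (show {p : Fin d → ℝ | ∀ i, (p i : EReal) ≤ a i} ⊆ {p | p ≤ z} from
      fun _ hx i => EReal.coe_le_coe_iff.1 ((hx i).trans (hz i).1.le)) (fun _ => zero_le_one) x

lemma indR_le_indE (hz : z ∈ cellE a b) (x : Fin d → ℝ) : indR z x ≤ indE b x :=
  indicator_le_indicator_of_subset
    (show {p : Fin d → ℝ | p ≤ z} ⊆ {p | ∀ i, (p i : EReal) ≤ b i} from
      fun _ hx i => (EReal.coe_le_coe_iff.2 (hx i)).trans (hz i).2) (fun _ => zero_le_one) x

lemma indR_injective : Function.Injective (indR (d := d)) := by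
  have key : ∀ z w : Fin d → ℝ, indR z = indR w → z ≤ w := by
    intro z w hzw
    by_contra hle
    have := congrFun hzw z
    simp [indR, hle] at this
  exact fun z w hzw => le_antisymm (key z w hzw) (key w z hzw.symm)

lemma index_eq_of_mem_cellE {t : Fin d → ℕ → EReal} (ht : ∀ i, Monotone (t i))
    {m n : Fin d → ℕ} {x : Fin d → ℝ}
    (hm : x ∈ cellE (fun i => t i (m i)) (fun i => t i (m i + 1)))
    (hn : x ∈ cellE (fun i => t i (n i)) (fun i => t i (n i + 1))) : m = n := by
  funext i
  by_contra hne
  rcases lt_or_gt_of_ne hne with h | h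
  · exact absurd (((hm i).2.trans (ht i h)).trans_lt (hn i).1) (lt_irrefl _)
  · exact absurd (((hn i).2.trans (ht i h)).trans_lt (hm i).1) (lt_irrefl _)

lemma exists_mem_grid_interval {t : ℕ → EReal} {k : ℕ} (ht0 : t 0 = ⊥) (htk : t k = ⊤) (x : ℝ) :
    ∃ n : Fin k, t n < x ∧ (x : EReal) ≤ t (n + 1) := by
  classical
  have hex : ∃ n, (x : EReal) ≤ t n := ⟨k, by simp [htk]⟩
  have hpos : Nat.find hex ≠ 0 := fun h0 => by
    have := Nat.find_spec hex
    rw [h0, ht0] at this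
    simp at this
  have hlek : Nat.find hex ≤ k := Nat.find_min' hex (by simp [htk])
  refine ⟨⟨Nat.find hex - 1, by omega⟩, not_le.1 (Nat.find_min hex (Nat.sub_one_lt hpos)), ?_⟩
  simp only [Nat.sub_add_cancel (Nat.one_le_iff_ne_zero.2 hpos)]
  exact Nat.find_spec hex

end Orthant

lemma setIntegral_preimage_le_of_condExp_le {Ω E : Type*} [MeasurableSpace Ω]
    [mE : MeasurableSpace E]
    {P : Measure Ω} [IsFiniteMeasure P] {X : Ω → E} (hX : Measurable X) {V : Ω → ℝ}
    (hV : Integrable V P) {h : E → ℝ} (hh : Integrable h (P.map X))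
    (hle : P[V | mE.comap X] ≤ᵐ[P] fun ω => h (X ω)) {D : Set E} (hD : MeasurableSet D) :
    ∫ ω in X ⁻¹' D, V ω ∂P ≤ ∫ x in D, h x ∂(P.map X) := by
  rw [setIntegral_map hD hh.aestronglyMeasurable hX.aemeasurable,
    ← setIntegral_condExp hX.comap_le hV ⟨D, hD, rfl⟩]
  exact setIntegral_mono_ae integrable_condExp.integrableOn
    (hh.comp_measurable hX).integrableOn hle

lemma exists_finset_superset_card_eq {α : Type*} {T : Set α} (hT : T.Infinite) {s : Finset α}
    (hs : ↑s ⊆ T) {N : ℕ} (hN : s.card ≤ N) :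
    ∃ t : Finset α, s ⊆ t ∧ ↑t ⊆ T ∧ t.card = N := by
  obtain ⟨u, hsu, huT, hu⟩ := hT.exists_superset_ncard_eq hs s.finite_toSet (k := N)
    (by rwa [ncard_coe_finset])
  rcases Nat.eq_zero_or_pos N with rfl | hpos
  · exact ⟨s, Finset.Subset.refl s, hs, by omega⟩
  · have hfin : u.Finite := finite_of_ncard_pos (hu ▸ hpos)
    exact ⟨hfin.toFinset, by simpa [← Finset.coe_subset] using hsu, by simpa using huT,
      by rw [← hu, ncard_eq_toFinset_card u hfin]⟩

section Cbar

variable {d : ℕ} {σ2 c : (Fin d → ℝ) → ℝ} {Q : ℕ}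

lemma le_cbar (u : Fin d → ℝ) : σ2 u ≤ cbar σ2 c Q u :=
  Finset.le_max' _ _ (Finset.mem_insert_self _ _)

lemma pow_le_cbar {i : ℕ} (hi : 2 ≤ i) (hiQ : i ≤ Q) (u : Fin d → ℝ) :
    c u ^ i ≤ cbar σ2 c Q u :=
  Finset.le_max' _ _ (Finset.mem_insert_of_mem
    (Finset.mem_image_of_mem _ (Finset.mem_Icc.2 ⟨hi, hiQ⟩)))

end Cbar

/-- **Bracketing construction for the marked indicator class**
(key step establishing assumption (A2) in the proof of Theorem 3.1(ii)).
For every `ε > 0` there are at most `(2dM/ε² + 1)^d` half-open cells partitioning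
`ℝ^d` such that each function `(u,x) ↦ u·1{x ≤ z}` is bracketed, with bounding
functions `b*(u,x) = |u|(1{x ≤ b_j} - 1{x ≤ a_j})` having second and higher
conditional-moment brackets of size `ε²`.  Consequently the bracketing number of
`F = {(u,x) ↦ u·1{x ≤ z} : z ∈ ℝ^d}` in `L₂(P)` is `O(ε^{-2d})`. -/
theorem statement13 {Ω : Type*} [MeasurableSpace Ω] (P : Measure Ω)
    [IsProbabilityMeasure P] {d : ℕ} (hd : 0 < d)
    (U : Ω → ℝ) (X : Ω → (Fin d → ℝ)) (hU : Measurable U) (hX : Measurable X)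
    (f : (Fin d → ℝ) → ℝ) (hf : Measurable f) (hf0 : ∀ x, 0 ≤ f x)
    (hXlaw : Measure.map X P =
      (volume : Measure (Fin d → ℝ)).withDensity fun x => ENNReal.ofReal (f x))
    (γ : ℝ) (hγ : 0 < γ) (Q : ℕ) (hQeven : Even Q) (hQ2 : 2 ≤ Q)
    (σ2 c : (Fin d → ℝ) → ℝ) (hσ2 : Measurable σ2) (hc : Measurable c)
    (hσ20 : ∀ x, 0 ≤ σ2 x) (hc0 : ∀ x, 0 ≤ c x)
    (hU2 : Integrable (fun ω => (U ω) ^ 2) P)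
    (hcondvar : P[fun ω => (U ω) ^ 2|MeasurableSpace.comap X inferInstance] =ᵐ[P]
      fun ω => σ2 (X ω))
    (hmomint : ∀ i : ℕ, 2 ≤ i → i ≤ Q →
      Integrable (fun ω => |U ω| ^ ((i : ℝ) * (2 + γ) / 2)) P)
    (hcondmom : ∀ i : ℕ, 2 ≤ i → i ≤ Q →
      P[fun ω => |U ω| ^ ((i : ℝ) * (2 + γ) / 2)|MeasurableSpace.comap X inferInstance]
        ≤ᵐ[P] fun ω => c (X ω) ^ i)
    (M : ℝ) (hMint : Integrable (fun u => cbar σ2 c Q u * f u)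
      (volume : Measure (Fin d → ℝ)))
    (hM : M = ∫ u, cbar σ2 c Q u * f u) :
    (∀ ε : ℝ, 0 < ε →
      ∃ N : ℕ, 0 < N ∧ (N : ℝ) ≤ (2 * d * M / ε ^ 2 + 1) ^ d ∧
        ∃ a b : Fin N → Fin d → EReal,
          (∀ j, a j ≤ b j) ∧
          (⋃ j, cellE (a j) (b j)) = univ ∧
          (∀ j k : Fin N, j ≠ k → Disjoint (cellE (a j) (b j)) (cellE (a k) (b k))) ∧
          ∀ z : Fin d → ℝ, ∃ j : Fin N, z ∈ cellE (a j) (b j) ∧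
            (∀ (u : ℝ) (x : Fin d → ℝ),
              |u * indR z x - u * indE (b j) x| ≤ |u| * (indE (b j) x - indE (a j) x)) ∧
            (∫ ω, (|U ω| * (indE (b j) (X ω) - indE (a j) (X ω))) ^ 2 ∂P) ≤ ε ^ 2 ∧
            ∀ i : ℕ, 2 ≤ i → i ≤ Q →
              (∫ ω, (|U ω| * (indE (b j) (X ω) - indE (a j) (X ω)))
                  ^ ((i : ℝ) * (2 + γ) / 2) ∂P) ≤ ε ^ 2) ∧
    -- Consequently: the bracketing number of `F` in `L₂(P)` is `O(ε^{-2d})`,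
    -- with the approximating class contained in `F` itself.
    ∃ CN : ℝ, 0 < CN ∧ ∀ ε : ℝ, 0 < ε → ε ≤ 1 →
      ∃ A B : Finset ((ℝ × (Fin d → ℝ)) → ℝ),
        (↑A : Set ((ℝ × (Fin d → ℝ)) → ℝ)) ⊆
            {φ | ∃ z : Fin d → ℝ, φ = fun p => p.1 * indR z p.2} ∧
        B.card = A.card ∧ (A.card : ℝ) ≤ CN * (ε⁻¹) ^ (2 * d) ∧
        (∀ b ∈ B, Real.sqrt (∫ p, (b p) ^ 2
            ∂(Measure.map (fun ω => (U ω, X ω)) P)) < ε) ∧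
        ∀ z : Fin d → ℝ, ∃ φa ∈ A, ∃ φb ∈ B,
          ∀ p : ℝ × (Fin d → ℝ), |p.1 * indR z p.2 - φa p| ≤ φb p := by
  have hfm : Measurable fun x => ENNReal.ofReal (f x) := hf.ennreal_ofReal
  have hlt : ∀ᵐ x : Fin d → ℝ, ENNReal.ofReal (f x) < ⊤ := .of_forall fun _ => ENNReal.ofReal_lt_top
  have hsmul : ∀ x, (ENNReal.ofReal (f x)).toReal • cbar σ2 c Q x = cbar σ2 c Q x * f x := by
    intro x
    rw [ENNReal.toReal_ofReal (hf0 x), smul_eq_mul, mul_comm]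
  have hh0 : ∀ x, 0 ≤ cbar σ2 c Q x := fun x => (hσ20 x).trans (le_cbar x)
  have hh : Integrable (cbar σ2 c Q) (P.map X) := by
    rw [hXlaw, integrable_withDensity_iff_integrable_smul' hfm hlt]
    simpa only [hsmul] using hMint
  have hhM : ∫ x, cbar σ2 c Q x ∂(P.map X) = M := by
    rw [hXlaw, integral_withDensity_eq_integral_toReal_smul hfm hlt, hM]
    simp only [hsmul]
  have hL : ∀ (i : Fin d) (r : ℝ), P.map X {x | x i = r} = 0 := fun i r => by
    rw [hXlaw]
    exact withDensity_absolutelyContinuous _ _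
      (Measure.pi_hyperplane (α := fun _ : Fin d => ℝ) (fun _ => volume) i r)
  have hM0 : 0 ≤ M := hhM ▸ integral_nonneg hh0
  have hdR : (0 : ℝ) < d := by exact_mod_cast hd
  have hbracket : ∀ {a b : Fin d → EReal} {z w : Fin d → ℝ}, z ∈ cellE a b → w ∈ cellE a b →
      ∀ (u : ℝ) (x : Fin d → ℝ),
        |u * indR z x - u * indR w x| ≤ |u| * (indE b x - indE a x) := by
    intro a b z w hz hw u x
    rw [← mul_sub, abs_mul]
    refine mul_le_mul_of_nonneg_left (abs_le.2 ⟨?_, ?_⟩) (abs_nonneg u)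
    · linarith [indE_le_indR hz x, indR_le_indE hw x]
    · linarith [indE_le_indR hw x, indR_le_indE hz x]
  have hcover : ∀ ε : ℝ, 0 < ε →
      ∃ N : ℕ, 0 < N ∧ (N : ℝ) ≤ (2 * d * M / ε ^ 2 + 1) ^ d ∧
        ∃ a b : Fin N → Fin d → EReal,
          (∀ j, a j ≤ b j) ∧
          (⋃ j, cellE (a j) (b j)) = univ ∧
          (∀ j k : Fin N, j ≠ k → Disjoint (cellE (a j) (b j)) (cellE (a k) (b k))) ∧
          ∀ z : Fin d → ℝ, ∃ j : Fin N, z ∈ cellE (a j) (b j) ∧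
            (∀ (u : ℝ) (x : Fin d → ℝ),
              |u * indR z x - u * indE (b j) x| ≤ |u| * (indE (b j) x - indE (a j) x)) ∧
            (∫ ω, (|U ω| * (indE (b j) (X ω) - indE (a j) (X ω))) ^ 2 ∂P) ≤ ε ^ 2 ∧
            ∀ i : ℕ, 2 ≤ i → i ≤ Q →
              (∫ ω, (|U ω| * (indE (b j) (X ω) - indE (a j) (X ω)))
                  ^ ((i : ℝ) * (2 + γ) / 2) ∂P) ≤ ε ^ 2 := by
    intro ε hε
    set δ : ℝ := ε ^ 2 / d with hδ_def
    have hδ : 0 < δ := by positivity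
    set k : ℕ := ⌊M / δ⌋₊ + 1 with hk_def
    have hkle : (k : ℝ) ≤ M / δ + 1 := by
      rw [hk_def]
      push_cast
      linarith [Nat.floor_le (div_nonneg hM0 hδ.le)]
    have hMk : M ≤ k * δ := by
      rw [← div_le_iff₀ hδ, hk_def]
      push_cast
      exact (Nat.lt_floor_add_one _).le
    have hnk : ∀ n < k, n * δ ≤ M := by
      intro n hn
      rw [← le_div_iff₀ hδ, ← Nat.le_floor_iff (div_nonneg hM0 hδ.le)]
      omega
    choose t ht ht0 htk htδ using exists_axis_grid hL hh hh0 hδ (Nat.succ_pos _ : 0 < k)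
      (by rwa [hhM]) (by rwa [hhM])
    let e : Fin (k ^ d) ≃ (Fin d → Fin k) := finFunctionFinEquiv.symm
    have hab : ∀ j : Fin (k ^ d), (fun i => t i (e j i)) ≤ fun i => t i (e j i + 1) :=
      fun j i => ht i (Nat.le_succ _)
    have hmem : ∀ z : Fin d → ℝ, ∃ j : Fin (k ^ d),
        z ∈ cellE (fun i => t i (e j i)) (fun i => t i (e j i + 1)) := by
      intro z
      choose n hn using fun i => exists_mem_grid_interval (ht0 i) (htk i) (z i)
      exact ⟨e.symm n, fun i => by simpa using hn i⟩
    refine ⟨k ^ d, by positivity, ?_, fun j i => t i (e j i), fun j i => t i (e j i + 1), hab,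
      ?_, ?_, ?_⟩
    · push_cast
      refine pow_le_pow_left₀ k.cast_nonneg (hkle.trans ?_) d
      have h1 : M / δ = d * M / ε ^ 2 := by rw [hδ_def]; field_simp
      have h2 : 2 * d * M / ε ^ 2 = d * M / ε ^ 2 + d * M / ε ^ 2 := by ring
      have h3 : 0 ≤ d * M / ε ^ 2 := by positivity
      rw [h1, h2]
      linarith
    · exact eq_univ_of_forall fun z => mem_iUnion.2 (hmem z)
    · intro j l hjl
      refine Set.disjoint_left.2 fun x hxj hxl => hjl (e.injective ?_)
      have := index_eq_of_mem_cellE ht hxj hxl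
      exact funext fun i => Fin.ext (congrFun this i)
    · intro z
      obtain ⟨j, hj⟩ := hmem z
      set a : Fin d → EReal := fun i => t i (e j i) with ha_def
      set b : Fin d → EReal := fun i => t i (e j i + 1) with hb_def
      set D : Set (Fin d → ℝ) := {p : Fin d → ℝ | ∀ i, (p i : EReal) ≤ b i} \
        {p : Fin d → ℝ | ∀ i, (p i : EReal) ≤ a i} with hD_def
      have hD : MeasurableSet D := (measurableSet_orthant b).diff (measurableSet_orthant a)
      have hDε : ∫ x in D, cbar σ2 c Q x ∂(P.map X) ≤ ε ^ 2 := by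
        refine (setIntegral_orthant_sdiff_le_sum hh hh0 a b).trans ?_
        refine (Finset.sum_le_sum fun i _ => htδ i (e j i) (e j i).2).trans_eq ?_
        rw [Finset.sum_const, Finset.card_univ, Fintype.card_fin, nsmul_eq_mul, hδ_def]
        field_simp
      have hind : ∀ x, indE b x - indE a x = D.indicator (fun _ => (1 : ℝ)) x :=
        indE_sub_indE (hab j)
      have hmoment : ∀ {V : Ω → ℝ}, Integrable V P →
          P[V|MeasurableSpace.comap X inferInstance] ≤ᵐ[P] (fun ω => cbar σ2 c Q (X ω)) →
          ∫ ω, (X ⁻¹' D).indicator V ω ∂P ≤ ε ^ 2 := by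
        intro V hV hle
        rw [integral_indicator (hX hD)]
        exact (setIntegral_preimage_le_of_condExp_le hX hV hh hle hD).trans hDε
      refine ⟨j, hj, fun u x => ?_, ?_, fun i hi hiQ => ?_⟩
      · rw [← mul_sub, abs_mul]
        refine mul_le_mul_of_nonneg_left (abs_le.2 ⟨?_, ?_⟩) (abs_nonneg u)
        · linarith [indE_le_indR hj x]
        · linarith [indR_le_indE hj x, indE_le_indR hj x]
      · refine le_of_eq_of_le (integral_congr_ae (.of_forall fun ω => ?_))
          (hmoment hU2 (hcondvar.le.trans (.of_forall fun ω => le_cbar (X ω))))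
        change (|U ω| * (indE b (X ω) - indE a (X ω))) ^ 2 = _
        rw [hind]
        by_cases hω : X ω ∈ D <;> simp [hω]
      · refine le_of_eq_of_le (integral_congr_ae (.of_forall fun ω => ?_))
          (hmoment (hmomint i hi hiQ)
            ((hcondmom i hi hiQ).trans (.of_forall fun ω => pow_le_cbar hi hiQ (X ω))))
        have hp : (i : ℝ) * (2 + γ) / 2 ≠ 0 := by
          have : (0 : ℝ) < i := by exact_mod_cast (by omega : 0 < i)
          positivity
        change (|U ω| * (indE b (X ω) - indE a (X ω))) ^ ((i : ℝ) * (2 + γ) / 2) = _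
        rw [hind]
        by_cases hω : X ω ∈ D
        · simp [hω]
        · simp [hω, Real.zero_rpow hp]
  refine ⟨hcover, (8 * d * M + 1) ^ d, by positivity, fun ε hε hε1 => ?_⟩
  obtain ⟨N, -, hN, a, b, -, -, -, hz⟩ := hcover (ε / 2) (by positivity)
  choose j hjmem _ hjint _ using hz
  set T : Set ((ℝ × (Fin d → ℝ)) → ℝ) :=
    {φ | ∃ z : Fin d → ℝ, φ = fun p => p.1 * indR z p.2} with hT_def
  set T' : Set ((ℝ × (Fin d → ℝ)) → ℝ) := {φ | Real.sqrt (∫ p, (φ p) ^ 2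
    ∂(Measure.map (fun ω => (U ω, X ω)) P)) < ε} with hT'_def
  have hUX : Measurable fun ω => (U ω, X ω) := hU.prodMk hX
  have : IsProbabilityMeasure (Measure.map (fun ω => (U ω, X ω)) P) :=
    Measure.isProbabilityMeasure_map hUX.aemeasurable
  have hT : T.Infinite := by
    have : Nonempty (Fin d) := ⟨⟨0, hd⟩⟩
    refine (infinite_range_of_injective
      (f := fun (z : Fin d → ℝ) (p : ℝ × (Fin d → ℝ)) => p.1 * indR z p.2) ?_).mono ?_
    · intro z w hzw
      refine indR_injective (funext fun x => ?_)
      simpa using congrFun hzw (1, x)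
    · rintro _ ⟨z, rfl⟩
      exact ⟨z, rfl⟩
  have hT' : T'.Infinite := by
    refine ((Ioo_infinite hε).image (f := fun (r : ℝ) (_ : ℝ × (Fin d → ℝ)) => r)
      fun r _ s _ hrs => congrFun hrs (0, 0)).mono ?_
    rintro _ ⟨r, ⟨hr0, hrε⟩, rfl⟩
    simpa [hT'_def, Real.sqrt_sq hr0.le] using hrε
  classical
  set J : Finset (Fin N) := Finset.univ.filter fun l => l ∈ range j with hJ_def
  let r : Fin N → Fin d → ℝ := fun l => Function.invFun j l
  have hr : ∀ z, r (j z) ∈ cellE (a (j z)) (b (j z)) := by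
    intro z
    have hjr : j (r (j z)) = j z := Function.invFun_eq ⟨z, rfl⟩
    simpa only [hjr] using hjmem (r (j z))
  let φ : Fin N → (ℝ × (Fin d → ℝ)) → ℝ := fun l p => p.1 * indR (r l) p.2
  let ψ : Fin N → (ℝ × (Fin d → ℝ)) → ℝ := fun l p => |p.1| * (indE (b l) p.2 - indE (a l) p.2)
  have hJN : J.card ≤ N := (Finset.card_le_univ J).trans_eq (Fintype.card_fin N)
  obtain ⟨A, hφA, hAT, hAcard⟩ := exists_finset_superset_card_eq hT (s := J.image φ) (N := N)
    (by
      intro _ h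
      obtain ⟨l, -, rfl⟩ := Finset.mem_image.1 (Finset.mem_coe.1 h)
      exact ⟨r l, rfl⟩)
    (Finset.card_image_le.trans hJN)
  obtain ⟨B, hψB, hBT, hBcard⟩ := exists_finset_superset_card_eq hT' (s := J.image ψ) (N := N)
    (by
      intro _ h
      obtain ⟨l, hl, rfl⟩ := Finset.mem_image.1 (Finset.mem_coe.1 h)
      obtain ⟨z, rfl⟩ := (Finset.mem_filter.1 hl).2
      have hmeasE : ∀ v : Fin d → EReal, Measurable (indE v) :=
        fun v => measurable_const.indicator (measurableSet_orthant v)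
      have hψm : Measurable (ψ (j z)) := (measurable_fst.abs).mul
        (((hmeasE _).comp measurable_snd).sub ((hmeasE _).comp measurable_snd))
      change Real.sqrt _ < ε
      rw [integral_map hUX.aemeasurable (hψm.pow_const 2).aestronglyMeasurable]
      refine (Real.sqrt_le_sqrt (hjint z)).trans_lt ?_
      rw [Real.sqrt_sq (by positivity)]
      linarith)
    (Finset.card_image_le.trans hJN)
  refine ⟨A, B, hAT, hBcard.trans hAcard.symm, ?_, fun ξ hξ => hBT hξ, fun z => ?_⟩
  · rw [hAcard, pow_mul, ← mul_pow]
    refine hN.trans (pow_le_pow_left₀ (by positivity) ?_ d)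
    have h1 : 2 * d * M / (ε / 2) ^ 2 = 8 * d * M * ε⁻¹ ^ 2 := by field_simp; ring
    have h2 : 1 ≤ ε⁻¹ ^ 2 := one_le_pow₀ ((one_le_inv₀ hε).2 hε1)
    rw [h1]
    linarith
  · have hjJ : j z ∈ J := Finset.mem_filter.2 ⟨Finset.mem_univ _, z, rfl⟩
    exact ⟨φ (j z), hφA (Finset.mem_image_of_mem φ hjJ), ψ (j z),
      hψB (Finset.mem_image_of_mem ψ hjJ), fun p => hbracket (hjmem z) (hr z) p.1 p.2⟩

end
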